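/- arXiv:1804.01474 — 10 statements merged into one kernel-verified Lean document; each statement's English description precedes it below -/
import Mathlib

section
/- A function f : V → ℝ satisfies L^V f = 0 if and only if for every hyperedge h ∈ H one has Σ_{v input of h} f(v) = Σ_{w output of h} f(w). A function γ : H → ℝ satisfies L^H γ = 0 if and only if for every vertex v ∈ V one has Σ_{h : v input of h} γ(h) = Σ_{h : v output of h} γ(h). -/
open Finset

/-- A chemical hypergraph: each hyperedge has a nonempty set of inputs and a
nonempty set of outputs (a vertex in both is a catalyst). -/
structure ChemHypergraph (V H : Type) where
  inputs : H → Finset V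
  outputs : H → Finset V
  inputs_nonempty : ∀ h, (inputs h).Nonempty
  outputs_nonempty : ∀ h, (outputs h).Nonempty

namespace ChemHypergraph

variable {V H : Type} [Fintype V] [Fintype H] [DecidableEq V] [DecidableEq H]

/-- The degree of a vertex: the number of hyperedges in which it is an input or an output. -/
def deg (G : ChemHypergraph V H) (v : V) : ℕ :=
  (Finset.univ.filter (fun h => v ∈ G.inputs h ∨ v ∈ G.outputs h)).card

/-- The scalar product for functions on vertices. -/
def innerV (G : ChemHypergraph V H) (f g : V → ℝ) : ℝ :=
  ∑ v, (G.deg v : ℝ) * f v * g v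

/-- The scalar product for functions on hyperedges. -/
def innerH (_G : ChemHypergraph V H) (ω γ : H → ℝ) : ℝ :=
  ∑ h, ω h * γ h

/-- The boundary operator δ. -/
def bdry (G : ChemHypergraph V H) (f : V → ℝ) : H → ℝ :=
  fun h => ∑ v ∈ G.inputs h, f v - ∑ w ∈ G.outputs h, f w

/-- The coboundary operator δ*. -/
noncomputable def cobdry (G : ChemHypergraph V H) (γ : H → ℝ) : V → ℝ :=
  fun v => ((∑ h ∈ Finset.univ.filter (fun h => v ∈ G.inputs h), γ h)
    - ∑ h ∈ Finset.univ.filter (fun h => v ∈ G.outputs h), γ h) / (G.deg v : ℝ)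

/-- The Laplace operator on vertex functions, L^V = δ* ∘ δ. -/
noncomputable def LV (G : ChemHypergraph V H) (f : V → ℝ) : V → ℝ := G.cobdry (G.bdry f)

/-- The Laplace operator on hyperedge functions, L^H = δ ∘ δ*. -/
noncomputable def LH (G : ChemHypergraph V H) (γ : H → ℝ) : H → ℝ := G.bdry (G.cobdry γ)

/-- δ as a linear map. -/
def bdryLin (G : ChemHypergraph V H) : (V → ℝ) →ₗ[ℝ] (H → ℝ) where
  toFun := G.bdry
  map_add' f g := by
    funext h
    simp only [bdry, Pi.add_apply, Finset.sum_add_distrib]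
    ring
  map_smul' c f := by
    funext h
    simp only [bdry, Pi.smul_apply, smul_eq_mul, RingHom.id_apply, ← Finset.mul_sum]
    ring

/-- δ* as a linear map. -/
noncomputable def cobdryLin (G : ChemHypergraph V H) : (H → ℝ) →ₗ[ℝ] (V → ℝ) where
  toFun := G.cobdry
  map_add' γ η := by
    funext v
    simp only [cobdry, Pi.add_apply, Finset.sum_add_distrib]
    ring
  map_smul' c γ := by
    funext v
    simp only [cobdry, Pi.smul_apply, smul_eq_mul, RingHom.id_apply, ← Finset.mul_sum]
    ring

/-- L^V as a linear map. -/
noncomputable def LVlin (G : ChemHypergraph V H) : (V → ℝ) →ₗ[ℝ] (V → ℝ) :=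
  G.cobdryLin.comp G.bdryLin

/-- L^H as a linear map. -/
noncomputable def LHlin (G : ChemHypergraph V H) : (H → ℝ) →ₗ[ℝ] (H → ℝ) :=
  G.bdryLin.comp G.cobdryLin

/-- A vertex is a catalyst of a hyperedge if it is both an input and an output of it. -/
def catalyst (G : ChemHypergraph V H) (v : V) (h : H) : Prop :=
  v ∈ G.inputs h ∧ v ∈ G.outputs h

end ChemHypergraph

/-- δ and δ* are adjoint for the two scalar products. -/
theorem chem_adjoint
    {V H : Type} [Fintype V] [Fintype H] [DecidableEq V] [DecidableEq H]
    (G : ChemHypergraph V H) (hdeg : ∀ v : V, 1 ≤ G.deg v) (f : V → ℝ) (γ : H → ℝ) :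
    G.innerH (G.bdry f) γ = G.innerV f (G.cobdry γ) := by
  have key : ∀ S : H → Finset V, ∑ h, (∑ v ∈ S h, f v) * γ h =
      ∑ v, f v * ∑ h ∈ Finset.univ.filter (fun h => v ∈ S h), γ h := by
    intro S
    simp only [Finset.sum_mul, Finset.mul_sum]
    apply Finset.sum_comm'
    intro x y
    simp
  have hR : G.innerV f (G.cobdry γ) =
      ∑ v, (f v * ∑ h ∈ Finset.univ.filter (fun h => v ∈ G.inputs h), γ h
        - f v * ∑ h ∈ Finset.univ.filter (fun h => v ∈ G.outputs h), γ h) := by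
    unfold ChemHypergraph.innerV ChemHypergraph.cobdry
    refine Finset.sum_congr rfl fun v _ => ?_
    have hv : (G.deg v : ℝ) ≠ 0 := by
      have := hdeg v
      exact_mod_cast (by omega : G.deg v ≠ 0)
    field_simp
  rw [hR, Finset.sum_sub_distrib, ← key, ← key, ← Finset.sum_sub_distrib]
  unfold ChemHypergraph.innerH ChemHypergraph.bdry
  exact Finset.sum_congr rfl fun h _ => sub_mul _ _ _

/-- L^V f = 0 iff for every hyperedge the values of f on inputs and
outputs have the same sum; L^H γ = 0 iff for every vertex the values of γ on the
hyperedges having it as input and as output have the same sum. -/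
theorem kernel_characterizations
    {V H : Type} [Fintype V] [Fintype H] [DecidableEq V] [DecidableEq H]
    (G : ChemHypergraph V H) (hdeg : ∀ v : V, 1 ≤ G.deg v) :
    (∀ f : V → ℝ, G.LV f = 0 ↔
      ∀ h : H, ∑ v ∈ G.inputs h, f v = ∑ w ∈ G.outputs h, f w) ∧
    (∀ γ : H → ℝ, G.LH γ = 0 ↔
      ∀ v : V, ∑ h ∈ Finset.univ.filter (fun h => v ∈ G.inputs h), γ h =
        ∑ h ∈ Finset.univ.filter (fun h => v ∈ G.outputs h), γ h) := by
  refine ⟨fun f => ⟨fun hf h => ?_, fun hf => ?_⟩, fun γ => ⟨fun hγ v => ?_, fun hγ => ?_⟩⟩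
  · have hadj := chem_adjoint G hdeg f (G.bdry f)
    have h0 : G.cobdry (G.bdry f) = 0 := hf
    rw [h0] at hadj
    simp only [ChemHypergraph.innerH, ChemHypergraph.innerV, Pi.zero_apply, mul_zero,
      Finset.sum_const_zero] at hadj
    rw [Finset.sum_eq_zero_iff_of_nonneg (fun i _ => mul_self_nonneg _)] at hadj
    exact sub_eq_zero.mp (mul_self_eq_zero.mp (hadj h (Finset.mem_univ h)))
  · have h0 : G.bdry f = 0 := funext fun h => sub_eq_zero.mpr (hf h)
    unfold ChemHypergraph.LV
    rw [h0]
    exact G.cobdryLin.map_zero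
  · have hadj := chem_adjoint G hdeg (G.cobdry γ) γ
    have h0 : G.bdry (G.cobdry γ) = 0 := hγ
    rw [h0] at hadj
    simp only [ChemHypergraph.innerH, ChemHypergraph.innerV, Pi.zero_apply, zero_mul,
      Finset.sum_const_zero, mul_assoc] at hadj
    have hadj := hadj.symm
    rw [Finset.sum_eq_zero_iff_of_nonneg
      (fun i _ => mul_nonneg (Nat.cast_nonneg _) (mul_self_nonneg _))] at hadj
    have hv : (G.deg v : ℝ) ≠ 0 := by
      have := hdeg v
      exact_mod_cast (by omega : G.deg v ≠ 0)
    have h1 := mul_self_eq_zero.mp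
      ((mul_eq_zero.mp (hadj v (Finset.mem_univ v))).resolve_left hv)
    exact sub_eq_zero.mp ((div_eq_zero_iff.mp h1).resolve_right hv)
  · have h0 : G.cobdry γ = 0 := by
      funext v
      simp only [ChemHypergraph.cobdry, hγ v, sub_self, zero_div, Pi.zero_apply]
    unfold ChemHypergraph.LH
    rw [h0]
    exact G.bdryLin.map_zero
end

section
/- If Γ has a vertex v₀ that is a catalyst of every hyperedge containing it, then 0 is an eigenvalue of L^V; indeed the function f with f(v₀) = 1 and f(v) = 0 for v ≠ v₀ is a nonzero function in the kernel of L^V. -/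
open Finset

/-- if v₀ is a catalyst of every hyperedge containing it, then the
indicator function of v₀ is a nonzero element of the kernel of L^V, so 0 is an
eigenvalue of L^V. -/
theorem always_catalyst_gives_kernel
    {V H : Type} [Fintype V] [Fintype H] [DecidableEq V] [DecidableEq H]
    (G : ChemHypergraph V H) (hdeg : ∀ v : V, 1 ≤ G.deg v)
    (v0 : V)
    (hcat : ∀ h : H, (v0 ∈ G.inputs h ∨ v0 ∈ G.outputs h) → G.catalyst v0 h) :
    (fun v => if v = v0 then (1 : ℝ) else 0) ≠ 0 ∧
    G.LV (fun v => if v = v0 then (1 : ℝ) else 0) = 0 := by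
  constructor
  · intro h
    have := congrFun h v0
    simp at this
  · have hb : G.bdry (fun v => if v = v0 then (1 : ℝ) else 0) = 0 := by
      funext h
      have hiff : v0 ∈ G.inputs h ↔ v0 ∈ G.outputs h :=
        ⟨fun hi => (hcat h (Or.inl hi)).2, fun ho => (hcat h (Or.inr ho)).1⟩
      simp [ChemHypergraph.bdry, Finset.sum_ite_eq', hiff]
    funext v
    simp [ChemHypergraph.LV, hb, ChemHypergraph.cobdry]
end

section
/- Let m_V := dim ker L^V and N := |V|. If k distinct vertices of Γ are each a catalyst of every hyperedge containing them, then m_V ≥ k. Moreover, m_V = N (equivalently, 0 is the only eigenvalue of L^V, i.e. L^V = 0) if and only if every vertex of Γ is a catalyst of every hyperedge containing it. -/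
open Finset

theorem aux_bdry_single
    {V H : Type} [Fintype V] [Fintype H] [DecidableEq V] [DecidableEq H]
    (G : ChemHypergraph V H) (v : V) (h : H) :
    G.bdry (Pi.single v 1) h =
      (if v ∈ G.inputs h then (1 : ℝ) else 0) - (if v ∈ G.outputs h then (1 : ℝ) else 0) := by
  simp [ChemHypergraph.bdry, Finset.sum_pi_single]

theorem aux_le
    {V H : Type} [Fintype V] [Fintype H] [DecidableEq V] [DecidableEq H]
    (G : ChemHypergraph V H) (S : Finset V)
    (hS : ∀ v ∈ S, ∀ h : H, (v ∈ G.inputs h ∨ v ∈ G.outputs h) → G.catalyst v h) :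
    S.card ≤ Module.finrank ℝ (LinearMap.ker G.LVlin) := by
  have hmem : ∀ v : S, (Pi.single (v : V) (1 : ℝ) : V → ℝ) ∈ LinearMap.ker G.LVlin := by
    rintro ⟨v, hv⟩
    have h0 : G.bdryLin (Pi.single v 1) = 0 := by
      funext h
      change G.bdry (Pi.single v 1) h = 0
      rw [aux_bdry_single]
      have h1 := hS v hv h
      unfold ChemHypergraph.catalyst at h1
      by_cases hi : v ∈ G.inputs h <;> by_cases ho : v ∈ G.outputs h <;> simp_all
    rw [LinearMap.mem_ker, ChemHypergraph.LVlin, LinearMap.comp_apply, h0, map_zero]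
  have hli : LinearIndependent ℝ
      (fun v : S => (⟨Pi.single (v : V) (1 : ℝ), hmem v⟩ : LinearMap.ker G.LVlin)) := by
    apply LinearIndependent.of_comp (LinearMap.ker G.LVlin).subtype
    have := (Pi.linearIndependent_single_one V ℝ).comp (fun v : S => (v : V))
      Subtype.val_injective
    exact this
  simpa using hli.fintype_card_le_finrank

theorem aux_zero
    {V H : Type} [Fintype V] [Fintype H] [DecidableEq V] [DecidableEq H]
    (G : ChemHypergraph V H) (hdeg : ∀ v : V, 1 ≤ G.deg v) (hL : G.LVlin = 0) (v : V) (h : H)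
    (hv : v ∈ G.inputs h ∨ v ∈ G.outputs h) : G.catalyst v h := by
  have h1 : G.cobdry (G.bdry (Pi.single v 1)) v = 0 := by
    have := congrFun (LinearMap.congr_fun hL (Pi.single v 1)) v
    exact this
  have hd : (G.deg v : ℝ) ≠ 0 := by
    have := hdeg v
    positivity
  unfold ChemHypergraph.cobdry at h1
  rw [div_eq_zero_iff, or_iff_left hd, Finset.sum_filter, Finset.sum_filter,
    ← Finset.sum_sub_distrib] at h1
  have h2 : ∑ h, (G.bdry (Pi.single v 1) h) ^ 2 = 0 := by
    rw [← h1]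
    refine Finset.sum_congr rfl fun h _ => ?_
    rw [aux_bdry_single]
    split_ifs <;> norm_num
  have h3 := (Finset.sum_eq_zero_iff_of_nonneg (fun _ _ => sq_nonneg _)).1 h2 h (Finset.mem_univ h)
  rw [aux_bdry_single] at h3
  unfold ChemHypergraph.catalyst
  by_cases hi : v ∈ G.inputs h <;> by_cases ho : v ∈ G.outputs h <;> simp_all

/-- if the k vertices of S are always catalysts then m_V ≥ k; moreover
m_V = |V| (equivalently L^V = 0) iff every vertex is a catalyst of every hyperedge
containing it. -/
theorem kernel_dim_catalysts
    {V H : Type} [Fintype V] [Fintype H] [DecidableEq V] [DecidableEq H]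
    (G : ChemHypergraph V H) (hdeg : ∀ v : V, 1 ≤ G.deg v)
    (S : Finset V)
    (hS : ∀ v ∈ S, ∀ h : H, (v ∈ G.inputs h ∨ v ∈ G.outputs h) → G.catalyst v h) :
    S.card ≤ Module.finrank ℝ (LinearMap.ker G.LVlin) ∧
    (Module.finrank ℝ (LinearMap.ker G.LVlin) = Fintype.card V ↔
      ∀ v : V, ∀ h : H, (v ∈ G.inputs h ∨ v ∈ G.outputs h) → G.catalyst v h) ∧
    (Module.finrank ℝ (LinearMap.ker G.LVlin) = Fintype.card V ↔ G.LVlin = 0) := by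
  have hiff : Module.finrank ℝ (LinearMap.ker G.LVlin) = Fintype.card V ↔ G.LVlin = 0 := by
    rw [← LinearMap.ker_eq_top]
    constructor
    · intro h
      apply Submodule.eq_top_of_finrank_eq
      rw [h, Module.finrank_fintype_fun_eq_card]
    · intro h
      rw [h, finrank_top, Module.finrank_fintype_fun_eq_card]
  refine ⟨aux_le G S hS, ⟨fun h => aux_zero G hdeg (hiff.1 h), fun h => le_antisymm ?_ ?_⟩, hiff⟩
  · have := Submodule.finrank_le (LinearMap.ker G.LVlin)
    rwa [Module.finrank_fintype_fun_eq_card] at this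
  · exact aux_le G Finset.univ (fun v _ => h v)
end

section
/- Let Γ' be a connected graph on vertex set V (every hyperedge of Γ' has exactly one input and one output, and any two vertices of V are joined by a path of edges of Γ'), and let Γ be obtained from Γ' by adding one additional hyperedge h whose inputs and outputs are subsets of V with |inputs of h| ≠ |outputs of h|. Then 0 is not an eigenvalue of L^V of Γ; i.e., the only f : V → ℝ with L^V f = 0 is f = 0. -/
open Finset

/-- let Γ be obtained from a connected graph Γ' (every hyperedge other
than h₀ has exactly one input and one output, and any two vertices are joined by a
path of such edges) by adding one hyperedge h₀ with |inputs h₀| ≠ |outputs h₀|.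
Then 0 is not an eigenvalue of L^V: the only f with L^V f = 0 is f = 0. -/
theorem connected_graph_plus_unbalanced_hyperedge
    {V H : Type} [Fintype V] [Fintype H] [DecidableEq V] [DecidableEq H]
    (G : ChemHypergraph V H) (hdeg : ∀ v : V, 1 ≤ G.deg v)
    (h0 : H)
    (hgraph : ∀ h : H, h ≠ h0 → ∃ a b : V, G.inputs h = {a} ∧ G.outputs h = {b})
    (hconn : ∀ v w : V, Relation.ReflTransGen
      (fun x y => ∃ h : H, h ≠ h0 ∧ (x ∈ G.inputs h ∨ x ∈ G.outputs h) ∧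
        (y ∈ G.inputs h ∨ y ∈ G.outputs h)) v w)
    (hcard : (G.inputs h0).card ≠ (G.outputs h0).card) :
    ∀ f : V → ℝ, G.LV f = 0 → f = 0 := by
  intro f hf
  have key : ∀ v, (∑ h ∈ Finset.univ.filter (fun h => v ∈ G.inputs h), G.bdry f h)
      - ∑ h ∈ Finset.univ.filter (fun h => v ∈ G.outputs h), G.bdry f h = 0 := by
    intro v
    have h1 := congrFun hf v
    simp only [ChemHypergraph.LV, ChemHypergraph.cobdry, Pi.zero_apply, div_eq_zero_iff] at h1
    rcases h1 with h1 | h1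
    · exact h1
    · have h2 := hdeg v
      have h3 : G.deg v = 0 := by exact_mod_cast h1
      omega
  have hsum : ∀ S : H → Finset V,
      ∑ v, f v * ∑ h ∈ Finset.univ.filter (fun h => v ∈ S h), G.bdry f h
        = ∑ h, G.bdry f h * ∑ v ∈ S h, f v := by
    intro S
    simp only [Finset.sum_filter, Finset.mul_sum]
    rw [Finset.sum_comm]
    refine Finset.sum_congr rfl fun h _ => ?_
    rw [← Finset.sum_filter_add_sum_filter_not Finset.univ (fun v => v ∈ S h)]
    rw [Finset.sum_congr rfl (g := fun v => G.bdry f h * f v)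
      (by intro v hv; simp only [Finset.mem_filter] at hv; simp [hv.2, mul_comm])]
    rw [Finset.sum_eq_zero (s := Finset.univ.filter (fun v => ¬ v ∈ S h))
      (by intro v hv; simp only [Finset.mem_filter] at hv; simp [hv.2])]
    simp
  have hsq : ∑ h, G.bdry f h * G.bdry f h = 0 := by
    have h1 : ∑ h, G.bdry f h * G.bdry f h
        = ∑ h, G.bdry f h * ∑ v ∈ G.inputs h, f v
          - ∑ h, G.bdry f h * ∑ v ∈ G.outputs h, f v := by
      rw [← Finset.sum_sub_distrib]
      refine Finset.sum_congr rfl fun h _ => ?_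
      rw [← mul_sub]
      rfl
    rw [h1, ← hsum, ← hsum, ← Finset.sum_sub_distrib]
    refine Finset.sum_eq_zero fun v _ => ?_
    rw [← mul_sub, key v, mul_zero]
  have hb : ∀ h, G.bdry f h = 0 := by
    intro h
    have h1 := (Finset.sum_eq_zero_iff_of_nonneg
      (fun h _ => mul_self_nonneg (G.bdry f h))).1 hsq h (Finset.mem_univ h)
    exact mul_self_eq_zero.1 h1
  have hconst : ∀ v w, f v = f w := by
    intro v w
    induction hconn v w with
    | refl => rfl
    | tail _ hxy ih =>
      obtain ⟨h, hne, hx, hy⟩ := hxy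
      obtain ⟨a, b, ha, hb'⟩ := hgraph h hne
      have h1 := hb h
      simp only [ChemHypergraph.bdry, ha, hb', Finset.sum_singleton] at h1
      simp only [ha, hb', Finset.mem_singleton] at hx hy
      rw [ih]
      rcases hx with rfl | rfl <;> rcases hy with rfl | rfl <;> linarith
  funext v
  have h1 := hb h0
  simp only [ChemHypergraph.bdry] at h1
  rw [Finset.sum_congr rfl (fun w _ => hconst w v),
    Finset.sum_congr (s₁ := G.outputs h0) rfl (fun w _ => hconst w v)] at h1
  simp only [Finset.sum_const, nsmul_eq_mul] at h1
  rw [← sub_mul] at h1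
  rcases mul_eq_zero.1 h1 with h2 | h2
  · exact absurd (by exact_mod_cast sub_eq_zero.1 h2) hcard
  · exact h2
end

section
/- Let N > 2 and let Γ be the chemical hypergraph on vertices v₁, …, v_N with hyperedges h₁, …, h_N, where for each i the hyperedge h_i has exactly {v_i} as its set of inputs and {v_j : j ≠ i} as its set of outputs. Then the only f : V → ℝ with L^V f = 0 is f = 0; in particular 0 is not an eigenvalue of L^V. -/
open Finset

/-- for N > 2, the hypergraph on vertices v₁,…,v_N with hyperedges
h₁,…,h_N where h_i has input set {v_i} and output set {v_j : j ≠ i} has trivial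
kernel of L^V: the only f with L^V f = 0 is f = 0. -/
theorem all_but_one_output_no_zero_eigenvalue
    (N : ℕ) (hN : 2 < N) (G : ChemHypergraph (Fin N) (Fin N))
    (hin : ∀ i : Fin N, G.inputs i = {i})
    (hout : ∀ i : Fin N, G.outputs i = Finset.univ \ {i}) :
    ∀ f : Fin N → ℝ, G.LV f = 0 → f = 0 := by
  have key : ∀ g : Fin N → ℝ, (∀ i, 2 * g i - ∑ j, g j = 0) → g = 0 := by
    intro g hg
    have h1 : ∑ i, (2 * g i - ∑ j, g j) = 0 := Finset.sum_eq_zero (fun i _ => hg i)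
    rw [Finset.sum_sub_distrib, ← Finset.mul_sum, Finset.sum_const, Finset.card_univ,
      Fintype.card_fin, nsmul_eq_mul] at h1
    have hN' : (2 : ℝ) < N := by exact_mod_cast hN
    have h2 : (2 - (N : ℝ)) * ∑ j, g j = 0 := by linarith
    have h3 : ∑ j, g j = 0 := by
      rcases mul_eq_zero.mp h2 with h | h
      · linarith
      · exact h
    funext i
    have := hg i
    simp only [Pi.zero_apply]
    linarith
  have hsum : ∀ (g : Fin N → ℝ) (i : Fin N), ∑ j ∈ Finset.univ \ {i}, g j = ∑ j, g j - g i := by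
    intro g i
    have := Finset.sum_sdiff (f := g) (Finset.subset_univ {i})
    rw [Finset.sum_singleton] at this
    linarith
  intro f hf
  have hb : ∀ i, G.bdry f i = 2 * f i - ∑ j, f j := by
    intro i
    simp only [ChemHypergraph.bdry, hin, hout, hsum, Finset.sum_singleton]
    ring
  have hγ : G.bdry f = 0 := by
    apply key
    intro i
    have hi := congrFun hf i
    have hdeg : (G.deg i : ℝ) ≠ 0 := by
      have : 0 < G.deg i := by
        unfold ChemHypergraph.deg
        exact Finset.card_pos.mpr ⟨i, by simp [hin]⟩
      exact_mod_cast this.ne'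
    have e1 : Finset.univ.filter (fun h => i ∈ G.inputs h) = {i} := by
      ext j; simp [hin, eq_comm]
    have e2 : Finset.univ.filter (fun h => i ∈ G.outputs h) = Finset.univ \ {i} := by
      ext j; simp [hout, eq_comm]
    simp only [ChemHypergraph.LV, ChemHypergraph.cobdry, Pi.zero_apply] at hi
    rw [e1, e2, hsum, Finset.sum_singleton, div_eq_zero_iff] at hi
    rcases hi with h | h
    · linarith
    · exact absurd h hdeg
  apply key
  intro i
  rw [← hb, hγ, Pi.zero_apply]
end

section
/- If Γ contains a closed system of reactions, then 0 is an eigenvalue of L^H; indeed the indicator function γ of the hyperedge set H' of the closed system (γ(h) = 1 for h ∈ H', γ(h) = 0 otherwise) is a nonzero function in the kernel of L^H. -/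
open Finset

/-- if Γ contains a closed system of reactions H' (a nonempty set of
hyperedges such that every vertex is an input of exactly as many hyperedges of H'
as it is an output), then the indicator function of H' is a nonzero element of the
kernel of L^H; in particular 0 is an eigenvalue of L^H. -/
theorem closed_system_gives_zero_eigenvalue
    {V H : Type} [Fintype V] [Fintype H] [DecidableEq V] [DecidableEq H]
    (G : ChemHypergraph V H) (hdeg : ∀ v : V, 1 ≤ G.deg v)
    (H' : Finset H) (hne : H'.Nonempty)
    (hclosed : ∀ v : V, (H'.filter (fun h => v ∈ G.inputs h)).card =
      (H'.filter (fun h => v ∈ G.outputs h)).card) :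
    (fun h => if h ∈ H' then (1 : ℝ) else 0) ≠ 0 ∧
    G.LH (fun h => if h ∈ H' then (1 : ℝ) else 0) = 0 := by
  have key : ∀ p : H → Prop, ∀ _ : DecidablePred p,
      ∑ h ∈ Finset.univ.filter p, (if h ∈ H' then (1 : ℝ) else 0) = ((H'.filter p).card : ℝ) := by
    intro p _
    rw [Finset.sum_ite_mem, Finset.sum_const, nsmul_eq_mul, mul_one]
    congr 2
    ext h
    simp [and_comm]
  have hco : G.cobdry (fun h => if h ∈ H' then (1 : ℝ) else 0) = 0 := by
    funext v
    simp only [ChemHypergraph.cobdry, key, hclosed v, sub_self, zero_div, Pi.zero_apply]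
  refine ⟨?_, ?_⟩
  · obtain ⟨h, hh⟩ := hne
    intro h0
    have := congrFun h0 h
    simp [hh] at this
  · funext h
    simp [ChemHypergraph.LH, hco, ChemHypergraph.bdry]
end

section
/- If Γ has l linearly independent closed systems of reactions, then m_H ≥ l, where m_H := dim ker L^H; i.e., the multiplicity of the eigenvalue 0 of L^H is at least l. -/
open Finset

/-- if Γ has l linearly independent closed systems of reactions
(i.e. their indicator vectors in ℝ^H are linearly independent), then
m_H = dim ker L^H ≥ l. -/
theorem indep_closed_systems_lower_bound
    {V H : Type} [Fintype V] [Fintype H] [DecidableEq V] [DecidableEq H]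
    (G : ChemHypergraph V H) (hdeg : ∀ v : V, 1 ≤ G.deg v)
    (l : ℕ) (S : Fin l → Finset H)
    (hne : ∀ i, (S i).Nonempty)
    (hclosed : ∀ (i : Fin l) (v : V),
      ((S i).filter (fun h => v ∈ G.inputs h)).card =
      ((S i).filter (fun h => v ∈ G.outputs h)).card)
    (hindep : LinearIndependent ℝ
      (fun i : Fin l => (fun h => if h ∈ S i then (1 : ℝ) else 0 : H → ℝ))) :
    l ≤ Module.finrank ℝ (LinearMap.ker G.LHlin) := by
  have key : ∀ (T : Finset H) (p : H → Prop) [DecidablePred p],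
      (∑ h ∈ Finset.univ.filter p, (if h ∈ T then (1 : ℝ) else 0)) = ((T.filter p).card : ℝ) := by
    intro T p _
    rw [Finset.sum_ite_mem, Finset.sum_const, nsmul_eq_mul, mul_one]
    congr 2
    ext h
    simp [and_comm]
  have hmem : ∀ i : Fin l,
      (fun h => if h ∈ S i then (1 : ℝ) else 0 : H → ℝ) ∈ LinearMap.ker G.LHlin := by
    intro i
    have h0 : G.cobdryLin (fun h => if h ∈ S i then (1 : ℝ) else 0 : H → ℝ) = 0 := by
      funext v
      change G.cobdry _ v = 0
      unfold ChemHypergraph.cobdry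
      rw [key, key, hclosed i v, sub_self, zero_div]
    rw [LinearMap.mem_ker, ChemHypergraph.LHlin, LinearMap.comp_apply, h0, map_zero]
  have hli : LinearIndependent ℝ
      (fun i : Fin l => (⟨_, hmem i⟩ : LinearMap.ker G.LHlin)) :=
    LinearIndependent.of_comp (LinearMap.ker G.LHlin).subtype hindep
  simpa using hli.fintype_card_le_finrank
end

section
/- The kernel dimensions m_H := dim ker L^H and m_V := dim ker L^V are unchanged if a hyperedge h containing a catalyst v is replaced by the hyperedge obtained from h by removing v from both its input set and its output set (provided the resulting input and output sets are still nonempty and every vertex still has degree ≥ 1). -/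
open Finset

namespace ChemHypergraph

variable {V H : Type} [Fintype V] [Fintype H] [DecidableEq V] [DecidableEq H]

theorem adj_aux (G : ChemHypergraph V H) (hdeg : ∀ v : V, 1 ≤ G.deg v)
    (γ : H → ℝ) (f : V → ℝ) :
    ∑ v, (G.deg v : ℝ) * G.cobdry γ v * f v = ∑ h, γ h * G.bdry f h := by
  have e1 : ∀ v, (G.deg v : ℝ) * G.cobdry γ v * f v =
      ∑ h, ((if v ∈ G.inputs h then γ h * f v else 0)
        - (if v ∈ G.outputs h then γ h * f v else 0)) := by
    intro v
    have hd : (G.deg v : ℝ) ≠ 0 := by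
      have := hdeg v
      positivity
    unfold cobdry
    rw [mul_div_cancel₀ _ hd, Finset.sum_filter, Finset.sum_filter,
      ← Finset.sum_sub_distrib, Finset.sum_mul]
    refine Finset.sum_congr rfl fun h _ => ?_
    split_ifs <;> ring
  have e2 : ∀ h, γ h * G.bdry f h =
      ∑ v, ((if v ∈ G.inputs h then γ h * f v else 0)
        - (if v ∈ G.outputs h then γ h * f v else 0)) := by
    intro h
    unfold bdry
    rw [mul_sub, Finset.mul_sum, Finset.mul_sum, Finset.sum_sub_distrib]
    simp
  simp_rw [e1, e2]
  exact Finset.sum_comm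

theorem cobdry_zero_aux (G : ChemHypergraph V H) (hdeg : ∀ v : V, 1 ≤ G.deg v)
    (γ : H → ℝ) (h : ∑ h, γ h * G.bdry (G.cobdry γ) h = 0) : G.cobdry γ = 0 := by
  rw [← adj_aux G hdeg, Finset.sum_eq_zero_iff_of_nonneg] at h
  · funext v
    have hd : (G.deg v : ℝ) ≠ 0 := by
      have := hdeg v
      positivity
    simpa [hd] using h v (Finset.mem_univ v)
  · intro v _
    rw [mul_assoc]
    exact mul_nonneg (Nat.cast_nonneg _) (mul_self_nonneg _)

theorem mem_ker_LH_aux (G : ChemHypergraph V H) (hdeg : ∀ v : V, 1 ≤ G.deg v) (γ : H → ℝ) :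
    γ ∈ LinearMap.ker G.LHlin ↔ ∀ f : V → ℝ, ∑ h, γ h * G.bdry f h = 0 := by
  rw [LinearMap.mem_ker]
  constructor
  · intro h f
    have h' : G.bdry (G.cobdry γ) = 0 := h
    have := cobdry_zero_aux G hdeg γ (by simp [h'])
    rw [← adj_aux G hdeg]
    simp [this]
  · intro h
    have := cobdry_zero_aux G hdeg γ (h _)
    change G.bdryLin (G.cobdry γ) = 0
    rw [this, map_zero]

theorem mem_ker_LV_aux (G : ChemHypergraph V H) (hdeg : ∀ v : V, 1 ≤ G.deg v) (f : V → ℝ) :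
    f ∈ LinearMap.ker G.LVlin ↔ G.bdry f = 0 := by
  rw [LinearMap.mem_ker]
  constructor
  · intro h
    have h' : G.cobdry (G.bdry f) = 0 := h
    have h2 := adj_aux G hdeg (G.bdry f) f
    simp only [h', Pi.zero_apply, mul_zero, zero_mul, Finset.sum_const_zero] at h2
    have h3 := (Finset.sum_eq_zero_iff_of_nonneg
      (fun h _ => mul_self_nonneg (G.bdry f h))).1 h2.symm
    funext e
    simpa using h3 e (Finset.mem_univ e)
  · intro h
    change G.cobdryLin (G.bdry f) = 0
    rw [h, map_zero]

end ChemHypergraph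

/-- m_H and m_V are unchanged if a hyperedge h₀ containing a catalyst
v₀ is replaced by the hyperedge obtained by removing v₀ from its inputs and outputs
(provided the new input/output sets are nonempty — automatic for a chemical
hypergraph — and every vertex still has degree ≥ 1). -/
theorem remove_catalyst_preserves_kernel_dims
    {V H : Type} [Fintype V] [Fintype H] [DecidableEq V] [DecidableEq H]
    (G G' : ChemHypergraph V H)
    (hdeg : ∀ v : V, 1 ≤ G.deg v) (hdeg' : ∀ v : V, 1 ≤ G'.deg v)
    (h0 : H) (v0 : V) (hcat : G.catalyst v0 h0)
    (hin : G'.inputs h0 = G.inputs h0 \ {v0})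
    (hout : G'.outputs h0 = G.outputs h0 \ {v0})
    (hother : ∀ h : H, h ≠ h0 → G'.inputs h = G.inputs h ∧ G'.outputs h = G.outputs h) :
    Module.finrank ℝ (LinearMap.ker G'.LHlin) =
      Module.finrank ℝ (LinearMap.ker G.LHlin) ∧
    Module.finrank ℝ (LinearMap.ker G'.LVlin) =
      Module.finrank ℝ (LinearMap.ker G.LVlin) := by
  have hb : G'.bdry = G.bdry := by
    funext f h
    unfold ChemHypergraph.bdry
    by_cases hh : h = h0
    · subst hh
      rw [hin, hout, Finset.sdiff_singleton_eq_erase, Finset.sdiff_singleton_eq_erase,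
        Finset.sum_erase_eq_sub hcat.1, Finset.sum_erase_eq_sub hcat.2]
      ring
    · rw [(hother h hh).1, (hother h hh).2]
  have hH : LinearMap.ker G'.LHlin = LinearMap.ker G.LHlin := by
    ext γ
    rw [G'.mem_ker_LH_aux hdeg', G.mem_ker_LH_aux hdeg, hb]
  have hV : LinearMap.ker G'.LVlin = LinearMap.ker G.LVlin := by
    ext f
    rw [G'.mem_ker_LV_aux hdeg', G.mem_ker_LV_aux hdeg, hb]
  rw [hH, hV]
  exact ⟨rfl, rfl⟩
end

section
/- Let Γ be a bipartite chemical hypergraph with at least one hyperedge, and for each hyperedge h let |h| denote the number of vertices that are an input or an output of h. Then the largest eigenvalue μ₁ of L^V satisfies μ₁ ≥ (Σ_{h∈H} |h|²) / (Σ_{h∈H} |h|). Moreover, if Γ is a bipartite hypergraph on N vertices with |h| = N for every hyperedge h, then μ₁ = N. -/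
open Finset

/-- Double counting for the vertex scalar product. -/
theorem innerV_eq_aux {V H : Type} [Fintype V] [Fintype H] [DecidableEq V] [DecidableEq H]
    (G : ChemHypergraph V H) (f : V → ℝ) :
    G.innerV f f = ∑ h : H, ∑ v ∈ G.inputs h ∪ G.outputs h, f v ^ 2 := by
  have h1 : ∀ h : H, ∑ v ∈ G.inputs h ∪ G.outputs h, f v ^ 2
      = ∑ v : V, if v ∈ G.inputs h ∨ v ∈ G.outputs h then f v ^ 2 else 0 := by
    intro h
    rw [← Finset.sum_filter]
    congr 1
    ext v
    simp
  simp_rw [h1]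
  rw [Finset.sum_comm]
  unfold ChemHypergraph.innerV ChemHypergraph.deg
  refine Finset.sum_congr rfl fun v _ => ?_
  rw [← Finset.sum_filter, Finset.sum_const, nsmul_eq_mul]
  ring

/-- The squared boundary of a bipartite hypergraph is a squared signed sum. -/
theorem bdry_sq_aux {V H : Type} [Fintype V] [Fintype H] [DecidableEq V] [DecidableEq H]
    (G : ChemHypergraph V H) (V1 V2 : Finset V) (hdisj : Disjoint V1 V2)
    (hbip : ∀ h : H, (G.inputs h ⊆ V1 ∧ G.outputs h ⊆ V2) ∨
      (G.inputs h ⊆ V2 ∧ G.outputs h ⊆ V1)) (f : V → ℝ) (h : H) :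
    G.bdry f h * G.bdry f h =
      (∑ v ∈ G.inputs h ∪ G.outputs h, (if v ∈ V1 then (1 : ℝ) else -1) * f v) ^ 2 := by
  have e1 : ∀ S : Finset V, S ⊆ V1 →
      ∑ v ∈ S, (if v ∈ V1 then (1 : ℝ) else -1) * f v = ∑ v ∈ S, f v := by
    intro S hS
    refine Finset.sum_congr rfl fun v hv => ?_
    rw [if_pos (hS hv), one_mul]
  have e2 : ∀ S : Finset V, S ⊆ V2 →
      ∑ v ∈ S, (if v ∈ V1 then (1 : ℝ) else -1) * f v = - ∑ v ∈ S, f v := by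
    intro S hS
    rw [← Finset.sum_neg_distrib]
    refine Finset.sum_congr rfl fun v hv => ?_
    rw [if_neg (Finset.disjoint_right.mp hdisj (hS hv)), neg_one_mul]
  unfold ChemHypergraph.bdry
  rcases hbip h with ⟨ha, hb⟩ | ⟨ha, hb⟩
  · rw [Finset.sum_union (Finset.disjoint_of_subset_left ha
      (Finset.disjoint_of_subset_right hb hdisj)), e1 _ ha, e2 _ hb]
    ring
  · rw [Finset.sum_union (Finset.disjoint_of_subset_left ha
      (Finset.disjoint_of_subset_right hb hdisj.symm)), e2 _ ha, e1 _ hb]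
    ring

/-- for a bipartite chemical hypergraph, the largest eigenvalue μ₁ of
L^V (the maximum of the Rayleigh quotient (δf,δf)_H / (f,f)_V over nonzero f)
satisfies μ₁ ≥ (Σ_h |h|²)/(Σ_h |h|); moreover if |h| = N = |V| for every hyperedge,
then μ₁ = N. -/
theorem bipartite_largest_eigenvalue
    {V H : Type} [Fintype V] [Fintype H] [DecidableEq V] [DecidableEq H] [Nonempty H]
    (G : ChemHypergraph V H) (hdeg : ∀ v : V, 1 ≤ G.deg v)
    (V1 V2 : Finset V) (hdisj : Disjoint V1 V2) (hunion : V1 ∪ V2 = Finset.univ)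
    (hbip : ∀ h : H, (G.inputs h ⊆ V1 ∧ G.outputs h ⊆ V2) ∨
      (G.inputs h ⊆ V2 ∧ G.outputs h ⊆ V1))
    (μ1 : ℝ)
    (hμ1 : IsGreatest {r : ℝ | ∃ f : V → ℝ, f ≠ 0 ∧
      r = G.innerH (G.bdry f) (G.bdry f) / G.innerV f f} μ1) :
    (∑ h : H, ((G.inputs h ∪ G.outputs h).card : ℝ) ^ 2) /
      (∑ h : H, ((G.inputs h ∪ G.outputs h).card : ℝ)) ≤ μ1 ∧
    ((∀ h : H, (G.inputs h ∪ G.outputs h).card = Fintype.card V) →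
      μ1 = Fintype.card V) := by
  have hsq : ∀ v, (if v ∈ V1 then (1 : ℝ) else -1) ^ 2 = 1 := by
    intro v
    split_ifs <;> norm_num
  obtain ⟨h0⟩ := ‹Nonempty H›
  obtain ⟨v0, hv0⟩ := G.inputs_nonempty h0
  have key : (∑ h : H, ((G.inputs h ∪ G.outputs h).card : ℝ) ^ 2) /
      (∑ h : H, ((G.inputs h ∪ G.outputs h).card : ℝ)) ≤ μ1 := by
    apply hμ1.2
    refine ⟨fun v => if v ∈ V1 then (1 : ℝ) else -1, ?_, ?_⟩
    · intro h
      have h2 := hsq v0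
      rw [congrFun h v0] at h2
      norm_num at h2
    · rw [innerV_eq_aux]
      unfold ChemHypergraph.innerH
      simp_rw [bdry_sq_aux G V1 V2 hdisj hbip, ← pow_two, hsq]
      simp
  refine ⟨key, fun hN => le_antisymm ?_ ?_⟩
  · obtain ⟨f, hf, rfl⟩ := hμ1.1
    apply div_le_of_le_mul₀
    · rw [innerV_eq_aux]
      positivity
    · positivity
    · rw [innerV_eq_aux, Finset.mul_sum]
      unfold ChemHypergraph.innerH
      refine Finset.sum_le_sum fun h _ => ?_
      rw [bdry_sq_aux G V1 V2 hdisj hbip, ← hN h]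
      refine sq_sum_le_card_mul_sum_sq.trans (le_of_eq ?_)
      simp_rw [mul_pow, hsq, one_mul]
  · refine le_trans (le_of_eq ?_) key
    simp_rw [hN]
    have hV : (Fintype.card V : ℝ) ≠ 0 := by
      have := Fintype.card_pos_iff.mpr ⟨v0⟩
      positivity
    have hH : (Fintype.card H : ℝ) ≠ 0 := by
      have := Fintype.card_pos_iff.mpr ⟨h0⟩
      positivity
    simp only [Finset.sum_const, Finset.card_univ, nsmul_eq_mul]
    field_simp
end

section
/- Fix a vertex v of Γ and let Γ' be the chemical hypergraph obtained from Γ by reversing the role of v in every hyperedge containing it: for each hyperedge h, v is an input of h in Γ' if and only if v is an output of h in Γ, and v is an output of h in Γ' if and only if v is an input of h in Γ, while all other vertices keep their roles. Then the Laplace operators L^V of Γ and of Γ' have the same eigenvalues with the same multiplicities, and likewise the operators L^H of Γ and of Γ' have the same eigenvalues with the same multiplicities. -/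
open Finset

/-- The sign flip at one vertex. -/
def flipFun {V : Type} [DecidableEq V] (v0 : V) (f : V → ℝ) : V → ℝ :=
  fun v => (if v = v0 then -1 else 1) * f v

/-- The sign flip at one vertex, as a linear equivalence. -/
def flipEquiv {V : Type} [DecidableEq V] (v0 : V) : (V → ℝ) ≃ₗ[ℝ] (V → ℝ) where
  toFun := flipFun v0
  invFun := flipFun v0
  map_add' f g := by
    funext v
    simp only [flipFun, Pi.add_apply]
    ring
  map_smul' c f := by
    funext v
    simp only [flipFun, Pi.smul_apply, smul_eq_mul, RingHom.id_apply]
    ring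
  left_inv f := by
    funext v
    simp only [flipFun]
    split_ifs <;> ring
  right_inv f := by
    funext v
    simp only [flipFun]
    split_ifs <;> ring

/-- reversing the role (input ↔ output) of a single vertex v₀ in all
hyperedges containing it leaves the spectra of L^V and of L^H unchanged, with
multiplicities: for every μ, the eigenspaces of L^V (resp. L^H) for μ in the two
hypergraphs have the same dimension. -/
theorem reverse_vertex_isospectral
    {V H : Type} [Fintype V] [Fintype H] [DecidableEq V] [DecidableEq H]
    (G G' : ChemHypergraph V H)
    (hdeg : ∀ v : V, 1 ≤ G.deg v) (hdeg' : ∀ v : V, 1 ≤ G'.deg v)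
    (v0 : V)
    (hrev : ∀ h : H, (v0 ∈ G'.inputs h ↔ v0 ∈ G.outputs h) ∧
      (v0 ∈ G'.outputs h ↔ v0 ∈ G.inputs h))
    (hsame : ∀ w : V, w ≠ v0 → ∀ h : H,
      (w ∈ G'.inputs h ↔ w ∈ G.inputs h) ∧ (w ∈ G'.outputs h ↔ w ∈ G.outputs h)) :
    ∀ μ : ℝ,
      Module.finrank ℝ (LinearMap.ker (G.LVlin - μ • LinearMap.id)) =
        Module.finrank ℝ (LinearMap.ker (G'.LVlin - μ • LinearMap.id)) ∧
      Module.finrank ℝ (LinearMap.ker (G.LHlin - μ • LinearMap.id)) =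
        Module.finrank ℝ (LinearMap.ker (G'.LHlin - μ • LinearMap.id)) := by
  have hd : ∀ v, G'.deg v = G.deg v := by
    intro v
    unfold ChemHypergraph.deg
    congr 1
    ext h
    simp only [Finset.mem_filter, Finset.mem_univ, true_and]
    by_cases hv : v = v0
    · subst hv
      rw [(hrev h).1, (hrev h).2, or_comm]
    · rw [(hsame v hv h).1, (hsame v hv h).2]
  have hb : ∀ f, G'.bdry (flipFun v0 f) = G.bdry f := by
    intro f
    funext h
    have key : ∀ (A : ChemHypergraph V H) (g : V → ℝ), A.bdry g h =
        ∑ v, ((if v ∈ A.inputs h then g v else 0) - (if v ∈ A.outputs h then g v else 0)) := by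
      intro A g
      simp [ChemHypergraph.bdry, Finset.sum_sub_distrib]
    rw [key, key]
    refine Finset.sum_congr rfl fun v _ => ?_
    by_cases hv : v = v0
    · subst hv
      simp only [(hrev h).1, (hrev h).2, flipFun, if_true]
      split_ifs <;> ring
    · simp only [(hsame v hv h).1, (hsame v hv h).2, flipFun, hv, if_false, one_mul]
  have hc : ∀ γ, G'.cobdry γ = flipFun v0 (G.cobdry γ) := by
    intro γ
    funext v
    by_cases hv : v = v0
    · subst hv
      simp only [ChemHypergraph.cobdry, flipFun, hd, (hrev _).1, (hrev _).2, if_true]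
      ring
    · simp only [ChemHypergraph.cobdry, flipFun, hd, (hsame v hv _).1, (hsame v hv _).2, hv,
        if_false, one_mul]
  have hH : G'.LHlin = G.LHlin := by
    refine LinearMap.ext fun γ => ?_
    change G'.bdry (G'.cobdry γ) = G.bdry (G.cobdry γ)
    rw [hc, hb]
  have hV : ∀ f, G'.LVlin (flipEquiv v0 f) = flipEquiv v0 (G.LVlin f) := by
    intro f
    change G'.cobdry (G'.bdry (flipFun v0 f)) = flipFun v0 (G.cobdry (G.bdry f))
    rw [hb, hc]
  intro μ
  refine ⟨?_, by rw [hH]⟩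
  have hk : LinearMap.ker (G.LVlin - μ • LinearMap.id) =
      (LinearMap.ker (G'.LVlin - μ • LinearMap.id)).comap
        (flipEquiv v0 : (V → ℝ) →ₗ[ℝ] (V → ℝ)) := by
    ext f
    have h1 : (G'.LVlin - μ • LinearMap.id : (V → ℝ) →ₗ[ℝ] (V → ℝ)) (flipEquiv v0 f) =
        flipEquiv v0 ((G.LVlin - μ • LinearMap.id : (V → ℝ) →ₗ[ℝ] (V → ℝ)) f) := by
      simp only [LinearMap.sub_apply, LinearMap.smul_apply, LinearMap.id_apply, hV, map_sub,
        map_smul]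
    rw [Submodule.mem_comap, LinearMap.mem_ker, LinearMap.mem_ker, LinearEquiv.coe_coe, h1,
      LinearEquiv.map_eq_zero_iff]
  rw [hk, ← LinearEquiv.finrank_map_eq (flipEquiv v0), Submodule.map_comap_eq_of_surjective]
  exact (flipEquiv v0).surjective
end
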